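/- There exists D > 0 depending only on C₀ such that the following holds: if ε, β > 0 satisfy β ≤ D²ε⁴, u is an admissible solution of (★) whose initial datum satisfies the data bounds with constant C₀, η ∈ C²(ℝ) has bounded second derivative, and T > 0, then there is a constant C depending only on C₀ such that β ∫₀^T ∫_ℝ |η″(u(t,x))| · |∂_x u(t,x)| · |∂_t∂_x u(t,x)| dx dt ≤ C ‖η″‖_{L^∞(ℝ)} β^{1/2}/ε ≤ C ‖η″‖_{L^∞(ℝ)} D ε and β² ∫₀^T ∫_ℝ |η″(u(t,x))| · |∂_x u(t,x)| · |∂_t∂_x³ u(t,x)| dx dt ≤ C ‖η″‖_{L^∞(ℝ)} β^{1/2}/ε ≤ C ‖η″‖_{L^∞(ℝ)} D ε. In particular both quantities tend to 0 as ε → 0. -/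

import Mathlib

open MeasureTheory Real Filter Set

noncomputable section

/-- `mixedD u j k t x`: `j` time derivatives of the `k`-th spatial derivative of `u` at `(t,x)`. -/
def mixedD (u : ℝ → ℝ → ℝ) (j k : ℕ) (t x : ℝ) : ℝ :=
  iteratedDeriv j (fun s => iteratedDeriv k (fun y => u s y) x) t

/-- Squared `L²` norm in the space variable. -/
def sqL2 (f : ℝ → ℝ) : ℝ := ∫ x : ℝ, (f x) ^ 2

/-- `L²` norm in the space variable. -/
def nL2 (f : ℝ → ℝ) : ℝ := Real.sqrt (∫ x : ℝ, (f x) ^ 2)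

/-- `L⁴` norm in the space variable. -/
def nL4 (f : ℝ → ℝ) : ℝ := (∫ x : ℝ, (f x) ^ 4) ^ ((1 : ℝ) / 4)

/-- Admissible solution of the Rosenau–KdV–RLW approximation (★). -/
structure IsAdmissibleKdVRLW (ε β : ℝ) (u : ℝ → ℝ → ℝ) : Prop where
  smooth : ContDiff ℝ (⊤ : ℕ∞) (fun p : ℝ × ℝ => u p.1 p.2)
  pde : ∀ t > (0 : ℝ), ∀ x : ℝ,
    mixedD u 1 0 t x + deriv (fun y => (u t y) ^ 2) x
      + β * mixedD u 0 3 t x - β * mixedD u 1 2 t x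
      + β ^ 2 * mixedD u 1 4 t x = ε * mixedD u 0 2 t x
  sq_int : ∀ T > (0 : ℝ), ∀ j k : ℕ, j + k ≤ 5 → ∀ t ∈ Set.Icc (0 : ℝ) T,
    MeasureTheory.Integrable (fun x : ℝ => (mixedD u j k t x) ^ 2)
  decay : ∀ T > (0 : ℝ), ∀ j k : ℕ, j + k ≤ 5 → ∀ δ > (0 : ℝ), ∃ M : ℝ,
    ∀ x : ℝ, M ≤ |x| → ∀ t ∈ Set.Icc (0 : ℝ) T, |mixedD u j k t x| ≤ δ

/-- Admissible solution of the Rosenau–RLW approximation (★★). -/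
structure IsAdmissibleRLW (ε β : ℝ) (u : ℝ → ℝ → ℝ) : Prop where
  smooth : ContDiff ℝ (⊤ : ℕ∞) (fun p : ℝ × ℝ => u p.1 p.2)
  pde : ∀ t > (0 : ℝ), ∀ x : ℝ,
    mixedD u 1 0 t x + deriv (fun y => (u t y) ^ 2) x
      - β * mixedD u 1 2 t x + β ^ 2 * mixedD u 1 4 t x = ε * mixedD u 0 2 t x
  sq_int : ∀ T > (0 : ℝ), ∀ j k : ℕ, j + k ≤ 5 → ∀ t ∈ Set.Icc (0 : ℝ) T,
    MeasureTheory.Integrable (fun x : ℝ => (mixedD u j k t x) ^ 2)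
  decay : ∀ T > (0 : ℝ), ∀ j k : ℕ, j + k ≤ 5 → ∀ δ > (0 : ℝ), ∃ M : ℝ,
    ∀ x : ℝ, M ≤ |x| → ∀ t ∈ Set.Icc (0 : ℝ) T, |mixedD u j k t x| ≤ δ

/-- Data bounds with constant `C0` for the (★) approximation. -/
def DataBoundsKdVRLW (ε β C0 : ℝ) (f : ℝ → ℝ) : Prop :=
  (∫ x : ℝ, (f x) ^ 2) + (∫ x : ℝ, (f x) ^ 4)
      + (β + ε ^ 2) * (∫ x : ℝ, (deriv f x) ^ 2) ≤ C0 ∧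
  (β * ε + β * ε ^ 2 + β ^ 2) * (∫ x : ℝ, (iteratedDeriv 2 f x) ^ 2)
      + (β ^ 2 * ε ^ 2 + β ^ 3) * (∫ x : ℝ, (iteratedDeriv 3 f x) ^ 2) ≤ C0 ∧
  β ^ 4 * (∫ x : ℝ, (iteratedDeriv 4 f x) ^ 2) ≤ C0

/-- Data bounds with constant `C0` for the (★★) approximation. -/
def DataBoundsRLW (ε β C0 : ℝ) (f : ℝ → ℝ) : Prop :=
  (∫ x : ℝ, (f x) ^ 2) + (∫ x : ℝ, (f x) ^ 4)
    + β * ε ^ 2 * (∫ x : ℝ, (iteratedDeriv 2 f x) ^ 2) ≤ C0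

/-- `u ∈ L^∞((0,∞); L²(ℝ) ∩ L⁴(ℝ))`. -/
def BddL2L4 (u : ℝ → ℝ → ℝ) : Prop :=
  ∃ M : ℝ, ∀ t > (0 : ℝ), (∫ x : ℝ, (u t x) ^ 2) ≤ M ∧ (∫ x : ℝ, (u t x) ^ 4) ≤ M

/-- Entropy solution of `∂ₜ u + ∂ₓ (u²) = 0` with initial datum `u0`. -/
def IsEntropySolution (u : ℝ → ℝ → ℝ) (u0 : ℝ → ℝ) : Prop :=
  ∀ η : ℝ → ℝ, ContDiff ℝ 2 η → ConvexOn ℝ Set.univ η →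
    (∃ M : ℝ, ∀ v : ℝ, |deriv η v| ≤ M) →
    ∀ φ : ℝ → ℝ → ℝ, ContDiff ℝ (⊤ : ℕ∞) (fun p : ℝ × ℝ => φ p.1 p.2) →
      HasCompactSupport (fun p : ℝ × ℝ => φ p.1 p.2) →
      (∀ t x : ℝ, 0 ≤ φ t x) →
      0 ≤ (∫ t in Set.Ioi (0 : ℝ), ∫ x : ℝ,
            (η (u t x) * deriv (fun s => φ s x) t
              + (∫ ξ in (0 : ℝ)..(u t x), 2 * ξ * deriv η ξ) * deriv (fun y => φ t y) x))
          + ∫ x : ℝ, η (u0 x) * φ 0 x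

open scoped Topology Interval

/-! ### Uniform decay at spatial infinity -/

/-- `F (t, x) → 0` as `|x| → ∞`, uniformly for `t ∈ [0, T]`. -/
def DecaysOn (T : ℝ) (F : ℝ × ℝ → ℝ) : Prop :=
  ∀ δ > (0 : ℝ), ∃ M : ℝ, ∀ x : ℝ, M ≤ |x| → ∀ t ∈ Set.Icc (0 : ℝ) T, |F (t, x)| ≤ δ

namespace DecaysOn

variable {T : ℝ} {F G : ℝ × ℝ → ℝ}

theorem add (hF : DecaysOn T F) (hG : DecaysOn T G) : DecaysOn T (fun p => F p + G p) := by
  intro δ hδ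
  obtain ⟨M, hM⟩ := hF (δ / 2) (by positivity)
  obtain ⟨N, hN⟩ := hG (δ / 2) (by positivity)
  refine ⟨max M N, fun x hx t ht => ?_⟩
  have h₁ := hM x ((le_max_left _ _).trans hx) t ht
  have h₂ := hN x ((le_max_right _ _).trans hx) t ht
  have h₃ := abs_add_le (F (t, x)) (G (t, x))
  linarith

theorem mul (hF : DecaysOn T F) (hG : DecaysOn T G) : DecaysOn T (fun p => F p * G p) := by
  intro δ hδ
  obtain ⟨M, hM⟩ := hF δ hδ
  obtain ⟨N, hN⟩ := hG 1 one_pos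
  refine ⟨max M N, fun x hx t ht => ?_⟩
  have h₁ := hM x ((le_max_left _ _).trans hx) t ht
  have h₂ := hN x ((le_max_right _ _).trans hx) t ht
  rw [abs_mul]
  simpa using mul_le_mul h₁ h₂ (abs_nonneg _) hδ.le

theorem const_mul (c : ℝ) (hF : DecaysOn T F) : DecaysOn T (fun p => c * F p) := by
  intro δ hδ
  obtain ⟨M, hM⟩ := hF (δ / (|c| + 1)) (by positivity)
  refine ⟨M, fun x hx t ht => ?_⟩
  have h := hM x hx t ht
  rw [le_div_iff₀ (by positivity)] at h
  rw [abs_mul]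
  nlinarith [abs_nonneg (F (t, x))]

theorem sub (hF : DecaysOn T F) (hG : DecaysOn T G) : DecaysOn T (fun p => F p - G p) := by
  simpa [sub_eq_add_neg] using hF.add (hG.const_mul (-1))

end DecaysOn

/-! ### Partial derivatives in the plane -/

theorem Differentiable.hasDerivAt_fst {F : ℝ × ℝ → ℝ} (hF : Differentiable ℝ F) (t x : ℝ) :
    HasDerivAt (fun s => F (s, x)) (fderiv ℝ F (t, x) (1, 0)) t :=
  (hF (t, x)).hasFDerivAt.comp_hasDerivAt t ((hasDerivAt_id t).prodMk (hasDerivAt_const t x))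

theorem Differentiable.hasDerivAt_snd {F : ℝ × ℝ → ℝ} (hF : Differentiable ℝ F) (t x : ℝ) :
    HasDerivAt (fun y => F (t, y)) (fderiv ℝ F (t, x) (0, 1)) x :=
  (hF (t, x)).hasFDerivAt.comp_hasDerivAt x ((hasDerivAt_const x t).prodMk (hasDerivAt_id x))

theorem ContDiff.smooth_fderiv_apply {F : ℝ × ℝ → ℝ} (hF : ContDiff ℝ (⊤ : ℕ∞) F) (v : ℝ × ℝ) :
    ContDiff ℝ (⊤ : ℕ∞) fun p => fderiv ℝ F p v :=
  (hF.fderiv_right (m := (⊤ : ℕ∞)) (by simp)).clm_apply contDiff_const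

/-- Mixed second partial derivatives of a smooth function commute. -/
theorem ContDiff.fderiv_fderiv_apply_comm {F : ℝ × ℝ → ℝ} (hF : ContDiff ℝ (⊤ : ℕ∞) F)
    (v w p : ℝ × ℝ) :
    fderiv ℝ (fun q => fderiv ℝ F q v) p w = fderiv ℝ (fun q => fderiv ℝ F q w) p v := by
  have hd : DifferentiableAt ℝ (fderiv ℝ F) p :=
    (hF.fderiv_right (m := (⊤ : ℕ∞)) (by simp)).differentiable (by simp) p
  have h : ∀ v w, fderiv ℝ (fun q => fderiv ℝ F q v) p w = fderiv ℝ (fderiv ℝ F) p w v := by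
    intro v w
    rw [fderiv_clm_apply hd (differentiableAt_const v)]
    simp
  rw [h, h]
  exact second_derivative_symmetric
    (fun q => (hF.differentiable (by simp) q).hasFDerivAt) hd.hasFDerivAt w v

section MixedD

variable {u : ℝ → ℝ → ℝ}

theorem mixedD_zero_zero (t x : ℝ) : mixedD u 0 0 t x = u t x := by
  simp [mixedD]

theorem mixedD_zero_succ (k : ℕ) (t x : ℝ) :
    mixedD u 0 (k + 1) t x = deriv (mixedD u 0 k t) x := by
  have h : ∀ k, mixedD u 0 k t = iteratedDeriv k (u t) := fun k => by
    ext y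
    simp [mixedD]
  rw [h, h, iteratedDeriv_succ]

theorem mixedD_one (k : ℕ) (t x : ℝ) :
    mixedD u 1 k t x = deriv (fun s => mixedD u 0 k s x) t := by
  simp [mixedD, iteratedDeriv_one]

theorem smooth_mixedD_zero (hu : ContDiff ℝ (⊤ : ℕ∞) fun p : ℝ × ℝ => u p.1 p.2) (k : ℕ) :
    ContDiff ℝ (⊤ : ℕ∞) fun p : ℝ × ℝ => mixedD u 0 k p.1 p.2 := by
  induction k with
  | zero => simpa only [mixedD_zero_zero] using hu
  | succ k ih =>
    convert ih.smooth_fderiv_apply (0, 1) using 2 with p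
    rw [mixedD_zero_succ]
    exact ((ih.differentiable (by simp)).hasDerivAt_snd p.1 p.2).deriv

theorem mixedD_one_eq_fderiv (hu : ContDiff ℝ (⊤ : ℕ∞) fun p : ℝ × ℝ => u p.1 p.2) (k : ℕ)
    (p : ℝ × ℝ) :
    mixedD u 1 k p.1 p.2 = fderiv ℝ (fun q : ℝ × ℝ => mixedD u 0 k q.1 q.2) p (1, 0) := by
  rw [mixedD_one]
  exact (((smooth_mixedD_zero hu k).differentiable (by simp)).hasDerivAt_fst p.1 p.2).deriv

theorem mixedD_zero_succ_eq_fderiv (hu : ContDiff ℝ (⊤ : ℕ∞) fun p : ℝ × ℝ => u p.1 p.2) (k : ℕ)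
    (p : ℝ × ℝ) :
    mixedD u 0 (k + 1) p.1 p.2 =
      fderiv ℝ (fun q : ℝ × ℝ => mixedD u 0 k q.1 q.2) p (0, 1) := by
  rw [mixedD_zero_succ]
  exact (((smooth_mixedD_zero hu k).differentiable (by simp)).hasDerivAt_snd p.1 p.2).deriv

theorem smooth_mixedD_one (hu : ContDiff ℝ (⊤ : ℕ∞) fun p : ℝ × ℝ => u p.1 p.2) (k : ℕ) :
    ContDiff ℝ (⊤ : ℕ∞) fun p : ℝ × ℝ => mixedD u 1 k p.1 p.2 := by
  simpa only [mixedD_one_eq_fderiv hu] using (smooth_mixedD_zero hu k).smooth_fderiv_apply (1, 0)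

theorem hasDerivAt_mixedD_time (hu : ContDiff ℝ (⊤ : ℕ∞) fun p : ℝ × ℝ => u p.1 p.2) (k : ℕ)
    (t x : ℝ) : HasDerivAt (fun s => mixedD u 0 k s x) (mixedD u 1 k t x) t := by
  rw [mixedD_one_eq_fderiv hu k (t, x)]
  exact ((smooth_mixedD_zero hu k).differentiable (by simp)).hasDerivAt_fst t x

theorem hasDerivAt_mixedD_zero (hu : ContDiff ℝ (⊤ : ℕ∞) fun p : ℝ × ℝ => u p.1 p.2) (k : ℕ)
    (t x : ℝ) : HasDerivAt (fun y => mixedD u 0 k t y) (mixedD u 0 (k + 1) t x) x := by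
  rw [mixedD_zero_succ_eq_fderiv hu k (t, x)]
  exact ((smooth_mixedD_zero hu k).differentiable (by simp)).hasDerivAt_snd t x

theorem hasDerivAt_mixedD_one (hu : ContDiff ℝ (⊤ : ℕ∞) fun p : ℝ × ℝ => u p.1 p.2) (k : ℕ)
    (t x : ℝ) : HasDerivAt (fun y => mixedD u 1 k t y) (mixedD u 1 (k + 1) t x) x := by
  have h : mixedD u 1 (k + 1) t x =
      fderiv ℝ (fun p : ℝ × ℝ => mixedD u 1 k p.1 p.2) (t, x) (0, 1) := by
    rw [mixedD_one_eq_fderiv hu (k + 1) (t, x)]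
    simp_rw [mixedD_one_eq_fderiv hu k, mixedD_zero_succ_eq_fderiv hu k]
    exact (smooth_mixedD_zero hu k).fderiv_fderiv_apply_comm _ _ _
  rw [h]
  exact ((smooth_mixedD_one hu k).differentiable (by simp)).hasDerivAt_snd t x

end MixedD

/-! ### Integrals over rectangles and strips -/

/-- The integral over `[-R, R]` of a nonnegative continuous function increases with `R`. -/
theorem integral_symm_interval_mono {g : ℝ → ℝ} (hg : Continuous g) (h0 : ∀ x, 0 ≤ g x)
    {R R' : ℝ} (hR : 0 ≤ R) (hRR' : R ≤ R') :
    ∫ x in -R..R, g x ≤ ∫ x in -R'..R', g x :=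
  intervalIntegral.integral_mono_interval (by linarith) (by linarith) hRR'
    (Eventually.of_forall h0) (hg.intervalIntegrable _ _)

theorem integral_symm_interval_le_integral {g : ℝ → ℝ} (hg : Integrable g) (h0 : ∀ x, 0 ≤ g x)
    {R : ℝ} (hR : 0 ≤ R) : ∫ x in -R..R, g x ≤ ∫ x, g x := by
  rw [intervalIntegral.integral_of_le (by linarith)]
  exact setIntegral_le_integral hg (Eventually.of_forall h0)

/-- Integrated form of the differential inequality `∂ₜ e + ∂ₓ f + q ≤ 0` on the whole line, when
the flux `f` vanishes at spatial infinity. -/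
theorem integral_le_of_balance {e f q : ℝ × ℝ → ℝ} {T : ℝ} (hT : 0 ≤ T)
    (he : ContDiff ℝ 1 e) (hf : ContDiff ℝ 1 f) (hq : Continuous q)
    (he0 : ∀ p, 0 ≤ e p) (hq0 : ∀ p, 0 ≤ q p)
    (h_int : Integrable fun x => e (0, x)) (hdecay : DecaysOn T f)
    (hbal : ∀ t ∈ Ioo 0 T, ∀ x, ∃ a b, HasDerivAt (fun s => e (s, x)) a t ∧
      HasDerivAt (fun y => f (t, y)) b x ∧ a + b ≤ - q (t, x))
    {R : ℝ} (hR : 0 ≤ R) :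
    (∫ x in -R..R, e (T, x)) + ∫ t in (0 : ℝ)..T, ∫ x in -R..R, q (t, x) ≤ ∫ x, e (0, x) := by
  have hde : Continuous fun p => fderiv ℝ e p (1, 0) := by
    have := he.continuous_fderiv one_ne_zero
    fun_prop
  have hdf : Continuous fun p => fderiv ℝ f p (0, 1) := by
    have := hf.continuous_fderiv one_ne_zero
    fun_prop
  have he_cont := he.continuous
  have hf_cont := hf.continuous
  have hpt : ∀ t ∈ Ioo 0 T, ∀ x,
      fderiv ℝ e (t, x) (1, 0) + fderiv ℝ f (t, x) (0, 1) ≤ - q (t, x) := by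
    intro t ht x
    obtain ⟨a, b, ha, hb, hab⟩ := hbal t ht x
    rw [((he.differentiable one_ne_zero).hasDerivAt_fst t x).unique ha,
      ((hf.differentiable one_ne_zero).hasDerivAt_snd t x).unique hb]
    exact hab
  refine le_of_forall_pos_le_add fun δ hδ => ?_
  obtain ⟨M, hM⟩ := hdecay (δ / (2 * T + 1)) (by positivity)
  set S := max R M
  have hRS : R ≤ S := le_max_left _ _
  have hS : 0 ≤ S := hR.trans hRS
  have hdiv := integral2_divergence_prod_of_hasFDerivAt_off_countable e f (fderiv ℝ e)
    (fderiv ℝ f) 0 (-S) T S ∅ countable_empty he_cont.continuousOn hf_cont.continuousOn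
    (fun p _ => (he.differentiable one_ne_zero p).hasFDerivAt)
    (fun p _ => (hf.differentiable one_ne_zero p).hasFDerivAt)
    ((hde.add hdf).continuousOn.integrableOn_compact (isCompact_uIcc.prod isCompact_uIcc))
  have hqS : ∀ r : ℝ, Continuous fun t => ∫ x in -r..r, q (t, x) := fun r =>
    intervalIntegral.continuous_parametric_intervalIntegral_of_continuous'
      (f := fun t x => q (t, x)) (by simpa [Function.uncurry_def] using hq) _ _
  have hdS : Continuous fun t => ∫ x in -S..S,
      (fderiv ℝ e (t, x) (1, 0) + fderiv ℝ f (t, x) (0, 1)) :=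
    intervalIntegral.continuous_parametric_intervalIntegral_of_continuous'
      (f := fun t x => fderiv ℝ e (t, x) (1, 0) + fderiv ℝ f (t, x) (0, 1))
      (by unfold Function.uncurry; fun_prop) _ _
  have h₁ : (∫ t in (0 : ℝ)..T, ∫ x in -S..S,
      (fderiv ℝ e (t, x) (1, 0) + fderiv ℝ f (t, x) (0, 1)))
      ≤ ∫ t in (0 : ℝ)..T, -∫ x in -S..S, q (t, x) := by
    refine intervalIntegral.integral_mono_on_of_le_Ioo hT (hdS.intervalIntegrable _ _)
      ((hqS S).neg.intervalIntegrable _ _) fun t ht => ?_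
    rw [← intervalIntegral.integral_neg]
    refine intervalIntegral.integral_mono_on (by linarith) ?_ ?_ fun x _ => hpt t ht x
    · exact Continuous.intervalIntegrable
        ((hde.add hdf).comp (Continuous.prodMk_right t)) _ _
    · exact Continuous.intervalIntegrable (hq.neg.comp (Continuous.prodMk_right t)) _ _
  rw [intervalIntegral.integral_neg] at h₁
  have h₂ : ∀ x : ℝ, M ≤ |x| → |∫ t in (0 : ℝ)..T, f (t, x)| ≤ δ / (2 * T + 1) * T := by
    intro x hx
    have := intervalIntegral.norm_integral_le_of_norm_le_const (a := 0) (b := T)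
      (f := fun t => f (t, x)) (C := δ / (2 * T + 1)) fun t ht => by
        rw [uIoc_of_le hT] at ht
        exact hM x hx t ⟨ht.1.le, ht.2⟩
    simpa [abs_of_nonneg hT] using this
  have hSM : M ≤ |S| := (le_max_right R M).trans (le_abs_self S)
  have h₃ := abs_le.1 (h₂ S hSM)
  have h₄ := abs_le.1 (h₂ (-S) (by rwa [abs_neg]))
  have h₅ : δ / (2 * T + 1) * T * 2 ≤ δ := by
    rw [div_mul_eq_mul_div, div_mul_eq_mul_div, div_le_iff₀ (by positivity)]
    nlinarith
  have h₆ := integral_symm_interval_le_integral h_int (fun x => he0 _) hS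
  have h₇ := integral_symm_interval_mono (g := fun x => e (T, x)) (by fun_prop) (fun x => he0 _)
    hR hRS
  have h₈ : ∫ t in (0 : ℝ)..T, ∫ x in -R..R, q (t, x) ≤
      ∫ t in (0 : ℝ)..T, ∫ x in -S..S, q (t, x) :=
    intervalIntegral.integral_mono_on hT ((hqS R).intervalIntegrable _ _)
      ((hqS S).intervalIntegrable _ _) fun t _ =>
        integral_symm_interval_mono (by fun_prop) (fun x => hq0 _) hR hRS
  linarith [h₃.1, h₃.2, h₄.1, h₄.2]

/-- A bound for the integrals of a nonnegative function over the rectangles `[0, T] × [-R, R]`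
passes to the strip `[0, T] × ℝ`. -/
theorem integral_strip_le {g : ℝ × ℝ → ℝ} (hg : Continuous g) (hg0 : ∀ p, 0 ≤ g p)
    {T K : ℝ} (hT : 0 ≤ T) (hK : 0 ≤ K)
    (h_int : ∀ t ∈ Icc 0 T, Integrable fun x => g (t, x))
    (hbd : ∀ R, 0 ≤ R → ∫ t in (0 : ℝ)..T, ∫ x in -R..R, g (t, x) ≤ K) :
    ∫ t in (0 : ℝ)..T, ∫ x, g (t, x) ≤ K := by
  by_cases hi : IntervalIntegrable (fun t => ∫ x, g (t, x)) volume 0 T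
  swap
  · rwa [intervalIntegral.integral_undef hi]
  have hgR : ∀ R : ℝ, Continuous fun t => ∫ x in -R..R, g (t, x) := fun R =>
    intervalIntegral.continuous_parametric_intervalIntegral_of_continuous'
      (f := fun t x => g (t, x)) (by simpa [Function.uncurry_def] using hg) _ _
  have hmem : ∀ t, t ∈ Ι 0 T → t ∈ Icc 0 T := fun t ht => by
    rw [uIoc_of_le hT] at ht
    exact ⟨ht.1.le, ht.2⟩
  have hlim : Tendsto (fun R : ℝ => ∫ t in (0 : ℝ)..T, ∫ x in -R..R, g (t, x)) atTop
      (𝓝 (∫ t in (0 : ℝ)..T, ∫ x, g (t, x))) := by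
    refine intervalIntegral.tendsto_integral_filter_of_dominated_convergence
      (fun t => ∫ x, g (t, x)) (Eventually.of_forall fun R => (hgR R).aestronglyMeasurable)
      ?_ hi ?_
    · filter_upwards [eventually_ge_atTop (0 : ℝ)] with R hR
      refine Eventually.of_forall fun t ht => ?_
      rw [Real.norm_of_nonneg
        (intervalIntegral.integral_nonneg (by linarith) fun x _ => hg0 _)]
      exact integral_symm_interval_le_integral (h_int t (hmem t ht)) (fun x => hg0 _) hR
    · exact Eventually.of_forall fun t ht =>
        intervalIntegral_tendsto_integral (h_int t (hmem t ht)) tendsto_neg_atTop_atBot tendsto_id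
  exact le_of_tendsto hlim ((eventually_ge_atTop 0).mono hbd)

/-- One-dimensional Sobolev (Agmon) inequality, in a weighted form. -/
theorem mul_sq_le_of_integral_le {g g' : ℝ → ℝ} (hg : ∀ x, HasDerivAt g (g' x) x)
    (hg' : Continuous g') {s K : ℝ} (hs : 0 < s)
    (hdecay : ∀ δ > (0 : ℝ), ∃ M, ∀ x, M ≤ |x| → |g x| ≤ δ)
    (hbd : ∀ R, 0 ≤ R → ∫ x in -R..R, (g x ^ 2 + s ^ 2 * g' x ^ 2) ≤ K) (x : ℝ) :
    s * g x ^ 2 ≤ K := by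
  have hgc : Continuous g := continuous_iff_continuousAt.2 fun x => (hg x).continuousAt
  refine le_of_forall_pos_le_add fun δ hδ => ?_
  obtain ⟨M, hM⟩ := hdecay (min 1 (δ / s)) (by positivity)
  set R := max M |x|
  have hxR : |x| ≤ R := le_max_right _ _
  have hR : 0 ≤ R := (abs_nonneg x).trans hxR
  obtain ⟨hx₁, hx₂⟩ := abs_le.1 hxR
  have hb := hM (-R) (by rw [abs_neg]; exact (le_max_left _ _).trans (le_abs_self _))
  have hb₁ := hb.trans (min_le_left _ _)
  have hb₂ := hb.trans (min_le_right _ _)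
  have hftc : ∫ y in -R..x, 2 * s * (g y * g' y) = s * g x ^ 2 - s * g (-R) ^ 2 := by
    refine intervalIntegral.integral_eq_sub_of_hasDerivAt (f := fun y => s * g y ^ 2)
      (fun y _ => ?_) (Continuous.intervalIntegrable (by fun_prop) _ _)
    exact (((hg y).fun_pow 2).const_mul s).congr_deriv (by push_cast; ring)
  have h₁ : ∫ y in -R..x, 2 * s * (g y * g' y) ≤ ∫ y in -R..x, (g y ^ 2 + s ^ 2 * g' y ^ 2) :=
    intervalIntegral.integral_mono_on hx₁ (Continuous.intervalIntegrable (by fun_prop) _ _)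
      (Continuous.intervalIntegrable (by fun_prop) _ _)
      fun y _ => by nlinarith [sq_nonneg (g y - s * g' y)]
  have h₂ : ∫ y in -R..x, (g y ^ 2 + s ^ 2 * g' y ^ 2) ≤
      ∫ y in -R..R, (g y ^ 2 + s ^ 2 * g' y ^ 2) :=
    intervalIntegral.integral_mono_interval le_rfl hx₁ hx₂
      (Eventually.of_forall fun y => by positivity)
      (Continuous.intervalIntegrable (by fun_prop) _ _)
  have h₃ : s * g (-R) ^ 2 ≤ δ := by
    have h : g (-R) ^ 2 ≤ δ / s := by
      rw [← sq_abs]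
      nlinarith [abs_nonneg (g (-R))]
    rw [le_div_iff₀ hs] at h
    linarith
  linarith [hbd R hR]

/-! ### Energy estimates -/

/-- Coercivity of the dissipation produced by the combination of multipliers
`2 u - 2 β uₓₓ + u³ - β ε uₜₓₓ`, as soon as `β u²` is small compared with `ε²`. -/
theorem dissipation_lower_bound {ε β u u₁ u₂ v₁ v₂ v₃ : ℝ} (hε : 0 < ε) (hβ : 0 < β)
    (hu : 18 * β * u ^ 2 ≤ ε ^ 2) :
    1 / 4 * (ε * u₁ ^ 2 + β * ε * v₁ ^ 2 + β ^ 3 * ε * v₃ ^ 2) ≤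
      2 * ε * u₁ ^ 2 + (2 * ε * β * u₂ ^ 2 - 4 * β * u * u₁ * u₂)
        + (3 * ε * u ^ 2 * u₁ ^ 2 - 3 * β * u ^ 2 * u₁ * u₂ + 3 * β * u ^ 2 * u₁ * v₁
            - 3 * β ^ 2 * u ^ 2 * u₁ * v₃)
        + (β * ε * v₁ ^ 2 + β ^ 2 * ε * v₂ ^ 2 + β ^ 3 * ε * v₃ ^ 2
            - 2 * β * ε * u * u₁ * v₂ + β ^ 2 * ε * u₂ * v₃) := by
  obtain ⟨z, hz⟩ : ∃ z, β * u = ε * z := ⟨β * u / ε, by field_simp⟩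
  have hzβ : 18 * z ^ 2 ≤ β := by
    have h : ε ^ 2 * (18 * z ^ 2) ≤ ε ^ 2 * β := by
      have h₁ : ε ^ 2 * z ^ 2 = β ^ 2 * u ^ 2 := by rw [← mul_pow, ← hz, mul_pow]
      nlinarith
    exact le_of_mul_le_mul_left h (by positivity)
  have hu₂ := mul_nonneg (sub_nonneg.2 hzβ) (sq_nonneg u₂)
  have hv₁ := mul_nonneg (sub_nonneg.2 hzβ) (sq_nonneg v₁)
  have hv₃ := mul_nonneg (sub_nonneg.2 hzβ) (sq_nonneg (β * v₃))
  have hmain : 0 ≤ 7 / 4 * u₁ ^ 2 + 2 * β * u₂ ^ 2 - 4 * z * u₁ * u₂ + 3 * (u * u₁) ^ 2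
      - 3 * z * (u * u₁) * u₂ + 3 * z * (u * u₁) * v₁ - 3 * β * z * (u * u₁) * v₃
      + 3 / 4 * β * v₁ ^ 2 + β ^ 2 * v₂ ^ 2 + 3 / 4 * β ^ 3 * v₃ ^ 2
      - 2 * β * (u * u₁) * v₂ + β ^ 2 * u₂ * v₃ := by
    nlinarith [sq_nonneg (u₁ - 2 * z * u₂), sq_nonneg (u * u₁ - β * v₂),
      sq_nonneg (u * u₁ - 3 * z * u₂), sq_nonneg (u * u₁ + 3 * z * v₁),
      sq_nonneg (u * u₁ - 3 * z * (β * v₃)), mul_nonneg hβ.le (sq_nonneg (u₂ + β * v₃)),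
      mul_nonneg hβ.le (sq_nonneg u₂), mul_nonneg hβ.le (sq_nonneg v₁),
      sq_nonneg (u * u₁), sq_nonneg u₁]
  have := mul_nonneg hε.le hmain
  linear_combination this + (4 * u₁ * u₂ + 3 * u * u₁ * u₂ - 3 * u * u₁ * v₁
    + 3 * β * u * u₁ * v₃) * hz

namespace IsAdmissibleKdVRLW

variable {ε β C0 T : ℝ} {u : ℝ → ℝ → ℝ}

theorem decaysOn (hu : IsAdmissibleKdVRLW ε β u) (hT : 0 ≤ T) (j k : ℕ) (hjk : j + k ≤ 5) :
    DecaysOn T fun p => mixedD u j k p.1 p.2 := by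
  intro δ hδ
  obtain ⟨M, hM⟩ := hu.decay (T + 1) (by linarith) j k hjk δ hδ
  exact ⟨M, fun x hx t ht => hM x hx t ⟨ht.1, by linarith [ht.2]⟩⟩

theorem integrable_sq (hu : IsAdmissibleKdVRLW ε β u) {t : ℝ} (ht : 0 ≤ t) (j k : ℕ)
    (hjk : j + k ≤ 5) : Integrable fun x => mixedD u j k t x ^ 2 :=
  hu.sq_int (t + 1) (by linarith) j k hjk t ⟨ht, by linarith⟩

theorem pde_mixedD (hu : IsAdmissibleKdVRLW ε β u) {t : ℝ} (ht : 0 < t) (x : ℝ) :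
    mixedD u 1 0 t x + 2 * mixedD u 0 0 t x * mixedD u 0 1 t x + β * mixedD u 0 3 t x
      - β * mixedD u 1 2 t x + β ^ 2 * mixedD u 1 4 t x = ε * mixedD u 0 2 t x := by
  have h := hu.pde t ht x
  have hd : deriv (fun y => u t y ^ 2) x = 2 * mixedD u 0 0 t x * mixedD u 0 1 t x := by
    have := ((hasDerivAt_mixedD_zero hu.smooth 0 t x).fun_pow 2).deriv
    simp only [mixedD_zero_zero] at this ⊢
    rw [this]
    simp
  rwa [hd] at h

theorem data_mixedD (hdata : DataBoundsKdVRLW ε β C0 (u 0)) :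
    ((∫ x, mixedD u 0 0 0 x ^ 2) + (∫ x, mixedD u 0 0 0 x ^ 4)
      + (β + ε ^ 2) * (∫ x, mixedD u 0 1 0 x ^ 2) ≤ C0) ∧
    ((β * ε + β * ε ^ 2 + β ^ 2) * (∫ x, mixedD u 0 2 0 x ^ 2)
      + (β ^ 2 * ε ^ 2 + β ^ 3) * (∫ x, mixedD u 0 3 0 x ^ 2) ≤ C0) := by
  have h : ∀ k x, mixedD u 0 k 0 x = iteratedDeriv k (u 0) x := fun k x => by simp [mixedD]
  simpa only [h, iteratedDeriv_zero, iteratedDeriv_one] using ⟨hdata.1, hdata.2.1⟩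

/-- The `L²`-type energy estimate, localized in space. -/
theorem integral_energy_le (hu : IsAdmissibleKdVRLW ε β u) (hε : 0 < ε) (hβ : 0 < β)
    (hdata : DataBoundsKdVRLW ε β C0 (u 0)) (hT : 0 ≤ T) {R : ℝ} (hR : 0 ≤ R) :
    ∫ x in -R..R, (1 / 2 * mixedD u 0 0 T x ^ 2 + β / 2 * mixedD u 0 1 T x ^ 2
      + β ^ 2 / 2 * mixedD u 0 2 T x ^ 2) ≤ C0 := by
  have hs := hu.smooth
  have s := fun k => (smooth_mixedD_zero hs k).of_le (m := 1) (by simp)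
  have r := fun k => (smooth_mixedD_one hs k).of_le (m := 1) (by simp)
  have i := fun k hk => hu.integrable_sq le_rfl 0 k hk
  have d := fun k => hu.decaysOn hT 0 k
  have b := fun k => hu.decaysOn hT 1 k
  have d0 := d 0 (by norm_num)
  have d1 := d 1 (by norm_num)
  have d2 := d 2 (by norm_num)
  have b1 := b 1 (by norm_num)
  have b2 := b 2 (by norm_num)
  have b3 := b 3 (by norm_num)
  have i0 := (i 0 (by norm_num)).const_mul (1 / 2)
  have i1 := (i 1 (by norm_num)).const_mul (β / 2)
  have i2 := (i 2 (by norm_num)).const_mul (β ^ 2 / 2)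
  have h := integral_le_of_balance (T := T)
    (e := fun p => 1 / 2 * mixedD u 0 0 p.1 p.2 ^ 2 + β / 2 * mixedD u 0 1 p.1 p.2 ^ 2
      + β ^ 2 / 2 * mixedD u 0 2 p.1 p.2 ^ 2)
    (f := fun p => 2 / 3 * (mixedD u 0 0 p.1 p.2 * mixedD u 0 0 p.1 p.2 * mixedD u 0 0 p.1 p.2)
      + β * (mixedD u 0 0 p.1 p.2 * mixedD u 0 2 p.1 p.2)
      - β / 2 * (mixedD u 0 1 p.1 p.2 * mixedD u 0 1 p.1 p.2)
      - β * (mixedD u 0 0 p.1 p.2 * mixedD u 1 1 p.1 p.2)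
      + β ^ 2 * (mixedD u 0 0 p.1 p.2 * mixedD u 1 3 p.1 p.2)
      - β ^ 2 * (mixedD u 0 1 p.1 p.2 * mixedD u 1 2 p.1 p.2)
      - ε * (mixedD u 0 0 p.1 p.2 * mixedD u 0 1 p.1 p.2))
    (q := fun p => ε * mixedD u 0 1 p.1 p.2 ^ 2) hT ?_ ?_ ?_ (fun p => by positivity)
    (fun p => by positivity) ((i0.fun_add i1).fun_add i2) ?_ ?_ hR
  · dsimp only at h
    rw [integral_add (i0.fun_add i1) i2, integral_add i0 i1, integral_const_mul, integral_const_mul,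
      integral_const_mul] at h
    obtain ⟨hd₁, hd₂⟩ := data_mixedD hdata
    have n : ∀ k, 0 ≤ ∫ x, mixedD u 0 k 0 x ^ 2 := fun k =>
      integral_nonneg fun x => sq_nonneg _
    have n4 : 0 ≤ ∫ x, mixedD u 0 0 0 x ^ 4 := integral_nonneg fun x => by positivity
    have nq : 0 ≤ ∫ t in (0 : ℝ)..T, ∫ x in -R..R, ε * mixedD u 0 1 t x ^ 2 :=
      intervalIntegral.integral_nonneg hT fun t _ =>
        intervalIntegral.integral_nonneg (by linarith) fun x _ => by positivity
    have m1 := mul_nonneg (sq_nonneg ε) (n 1)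
    have m2 := mul_nonneg (show 0 ≤ β * ε + β * ε ^ 2 by positivity) (n 2)
    have m3 := mul_nonneg (show 0 ≤ β ^ 2 * ε ^ 2 + β ^ 3 by positivity) (n 3)
    linarith [n 0]
  · fun_prop
  · fun_prop
  · exact continuous_const.mul ((s 1).continuous.pow 2)
  · repeat' first
      | assumption
      | apply DecaysOn.sub
      | apply DecaysOn.add
      | apply DecaysOn.const_mul
      | apply DecaysOn.mul
  · intro t ht x
    have τ := fun k => hasDerivAt_mixedD_time hs k t x
    have ξ := fun k => hasDerivAt_mixedD_zero hs k t x
    have ζ := fun k => hasDerivAt_mixedD_one hs k t x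
    refine ⟨_, _, ((((τ 0).fun_pow 2).const_mul _).fun_add (((τ 1).fun_pow 2).const_mul _)).fun_add
      (((τ 2).fun_pow 2).const_mul _),
      (((((((((ξ 0).fun_mul (ξ 0)).fun_mul (ξ 0)).const_mul _).fun_add
        (((ξ 0).fun_mul (ξ 2)).const_mul _)).fun_sub (((ξ 1).fun_mul (ξ 1)).const_mul _)).fun_sub
        (((ξ 0).fun_mul (ζ 1)).const_mul _)).fun_add (((ξ 0).fun_mul (ζ 3)).const_mul _)).fun_sub
        (((ξ 1).fun_mul (ζ 2)).const_mul _)).fun_sub (((ξ 0).fun_mul (ξ 1)).const_mul _), ?_⟩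
    refine le_of_eq ?_
    push_cast
    linear_combination mixedD u 0 0 t x * hu.pde_mixedD ht.1 x

theorem sqrt_mul_sq_le (hu : IsAdmissibleKdVRLW ε β u) (hε : 0 < ε) (hβ : 0 < β)
    (hdata : DataBoundsKdVRLW ε β C0 (u 0)) (hT : 0 ≤ T) (x : ℝ) :
    √β * mixedD u 0 0 T x ^ 2 ≤ 2 * C0 := by
  have c : ∀ k, Continuous fun y => mixedD u 0 k T y := fun k =>
    (smooth_mixedD_zero hu.smooth k).continuous.comp (Continuous.prodMk_right T)
  have c0 := c 0
  have c1 := c 1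
  have c2 := c 2
  refine mul_sq_le_of_integral_le (hasDerivAt_mixedD_zero hu.smooth 0 T) c1
    (Real.sqrt_pos.2 hβ) (fun δ hδ => ?_) (fun R hR => ?_) x
  · obtain ⟨M, hM⟩ := hu.decaysOn hT 0 0 (by norm_num) δ hδ
    exact ⟨M, fun y hy => hM y hy T ⟨hT, le_rfl⟩⟩
  · have h := hu.integral_energy_le hε hβ hdata hT hR
    rw [Real.sq_sqrt hβ.le]
    calc ∫ y in -R..R, (mixedD u 0 0 T y ^ 2 + β * mixedD u 0 1 T y ^ 2)
        ≤ ∫ y in -R..R, 2 * (1 / 2 * mixedD u 0 0 T y ^ 2 + β / 2 * mixedD u 0 1 T y ^ 2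
            + β ^ 2 / 2 * mixedD u 0 2 T y ^ 2) := by
          refine intervalIntegral.integral_mono_on (by linarith)
            (Continuous.intervalIntegrable (by fun_prop) _ _)
            (Continuous.intervalIntegrable (by fun_prop) _ _) fun y _ => ?_
          nlinarith [mul_nonneg (sq_nonneg β) (sq_nonneg (mixedD u 0 2 T y))]
      _ ≤ 2 * C0 := by
          rw [intervalIntegral.integral_const_mul]
          linarith

theorem integrable_pow_four (hu : IsAdmissibleKdVRLW ε β u) (hε : 0 < ε) (hβ : 0 < β)
    (hdata : DataBoundsKdVRLW ε β C0 (u 0)) : Integrable fun x => mixedD u 0 0 0 x ^ 4 := by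
  have c : Continuous fun y => mixedD u 0 0 0 y :=
    (smooth_mixedD_zero hu.smooth 0).continuous.comp (Continuous.prodMk_right 0)
  refine ((hu.integrable_sq le_rfl 0 0 (by norm_num)).const_mul (2 * C0 / √β)).mono'
    (c.pow 4).aestronglyMeasurable (Eventually.of_forall fun x => ?_)
  have h := hu.sqrt_mul_sq_le hε hβ hdata le_rfl x
  rw [Real.norm_of_nonneg (by positivity), show mixedD u 0 0 0 x ^ 4 =
    mixedD u 0 0 0 x ^ 2 * mixedD u 0 0 0 x ^ 2 by ring]
  refine mul_le_mul_of_nonneg_right ?_ (sq_nonneg _)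
  rw [le_div_iff₀ (Real.sqrt_pos.2 hβ)]
  linarith

/-- Space-time bounds for `ε uₓ²`, `β ε uₜₓ²` and `β³ ε uₜₓₓₓ²`. -/
theorem integral_dissipation_le (hu : IsAdmissibleKdVRLW ε β u) (hε : 0 < ε) (hβ : 0 < β)
    (hsmall : 36 * C0 * √β ≤ ε ^ 2) (hdata : DataBoundsKdVRLW ε β C0 (u 0)) (hT : 0 ≤ T)
    {R : ℝ} (hR : 0 ≤ R) :
    ∫ t in (0 : ℝ)..T, ∫ x in -R..R, 1 / 4 * (ε * mixedD u 0 1 t x ^ 2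
      + β * ε * mixedD u 1 1 t x ^ 2 + β ^ 3 * ε * mixedD u 1 3 t x ^ 2) ≤ 4 * C0 := by
  have hs := hu.smooth
  have s := fun k => (smooth_mixedD_zero hs k).of_le (m := 1) (by simp)
  have r := fun k => (smooth_mixedD_one hs k).of_le (m := 1) (by simp)
  have i := fun k hk => hu.integrable_sq le_rfl 0 k hk
  have d := fun k => hu.decaysOn hT 0 k
  have b := fun k => hu.decaysOn hT 1 k
  have d0 := d 0 (by norm_num)
  have d1 := d 1 (by norm_num)
  have d2 := d 2 (by norm_num)
  have b0 := b 0 (by norm_num)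
  have b1 := b 1 (by norm_num)
  have b2 := b 2 (by norm_num)
  have b3 := b 3 (by norm_num)
  have i4 := (hu.integrable_pow_four hε hβ hdata).const_mul (1 / 4)
  have i0 := i 0 (by norm_num)
  have i1 := (i 1 (by norm_num)).const_mul (2 * β)
  have i2 := (i 2 (by norm_num)).const_mul (β * ε ^ 2 / 2 + 2 * β ^ 2)
  have i3 := (i 3 (by norm_num)).const_mul (β ^ 3)
  have h := integral_le_of_balance (T := T)
    (e := fun p => 1 / 4 * mixedD u 0 0 p.1 p.2 ^ 4 + mixedD u 0 0 p.1 p.2 ^ 2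
      + 2 * β * mixedD u 0 1 p.1 p.2 ^ 2 + (β * ε ^ 2 / 2 + 2 * β ^ 2) * mixedD u 0 2 p.1 p.2 ^ 2
      + β ^ 3 * mixedD u 0 3 p.1 p.2 ^ 2)
    (f := fun p => 2 * (2 / 3 * (mixedD u 0 0 p.1 p.2 * mixedD u 0 0 p.1 p.2 * mixedD u 0 0 p.1 p.2)
      + β * (mixedD u 0 0 p.1 p.2 * mixedD u 0 2 p.1 p.2)
      - β / 2 * (mixedD u 0 1 p.1 p.2 * mixedD u 0 1 p.1 p.2)
      - β * (mixedD u 0 0 p.1 p.2 * mixedD u 1 1 p.1 p.2)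
      + β ^ 2 * (mixedD u 0 0 p.1 p.2 * mixedD u 1 3 p.1 p.2)
      - β ^ 2 * (mixedD u 0 1 p.1 p.2 * mixedD u 1 2 p.1 p.2)
      - ε * (mixedD u 0 0 p.1 p.2 * mixedD u 0 1 p.1 p.2))
      + (-2) * (β * (mixedD u 0 1 p.1 p.2 * mixedD u 1 0 p.1 p.2)
        + β ^ 2 / 2 * (mixedD u 0 2 p.1 p.2 * mixedD u 0 2 p.1 p.2)
        + β ^ 3 * (mixedD u 0 2 p.1 p.2 * mixedD u 1 3 p.1 p.2))
      + mixedD u 0 0 p.1 p.2 * mixedD u 0 0 p.1 p.2 * mixedD u 0 0 p.1 p.2 *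
        (2 / 5 * (mixedD u 0 0 p.1 p.2 * mixedD u 0 0 p.1 p.2) + β * mixedD u 0 2 p.1 p.2
          - β * mixedD u 1 1 p.1 p.2 + β ^ 2 * mixedD u 1 3 p.1 p.2 - ε * mixedD u 0 1 p.1 p.2)
      + (-(β * ε)) * (mixedD u 1 0 p.1 p.2 * mixedD u 1 1 p.1 p.2
        + β * (mixedD u 0 2 p.1 p.2 * mixedD u 1 2 p.1 p.2)
        + β ^ 2 * (mixedD u 1 3 p.1 p.2 * mixedD u 1 2 p.1 p.2)))
    (q := fun p => 1 / 4 * (ε * mixedD u 0 1 p.1 p.2 ^ 2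
      + β * ε * mixedD u 1 1 p.1 p.2 ^ 2 + β ^ 3 * ε * mixedD u 1 3 p.1 p.2 ^ 2))
    hT ?_ ?_ ?_ (fun p => by positivity)
    (fun p => by positivity) ((((i4.fun_add i0).fun_add i1).fun_add i2).fun_add i3) ?_ ?_ hR
  · dsimp only at h
    rw [integral_add (((i4.fun_add i0).fun_add i1).fun_add i2) i3,
      integral_add ((i4.fun_add i0).fun_add i1) i2, integral_add (i4.fun_add i0) i1,
      integral_add i4 i0, integral_const_mul, integral_const_mul,
      integral_const_mul, integral_const_mul] at h
    obtain ⟨hd₁, hd₂⟩ := data_mixedD hdata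
    have n : ∀ k, 0 ≤ ∫ x, mixedD u 0 k 0 x ^ 2 := fun k =>
      integral_nonneg fun x => sq_nonneg _
    have n4 : 0 ≤ ∫ x, mixedD u 0 0 0 x ^ 4 := integral_nonneg fun x => by positivity
    have ne : 0 ≤ ∫ x in -R..R, (1 / 4 * mixedD u 0 0 T x ^ 4 + mixedD u 0 0 T x ^ 2
      + 2 * β * mixedD u 0 1 T x ^ 2 + (β * ε ^ 2 / 2 + 2 * β ^ 2) * mixedD u 0 2 T x ^ 2
      + β ^ 3 * mixedD u 0 3 T x ^ 2) :=
      intervalIntegral.integral_nonneg (by linarith) fun x _ => by positivity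
    have m1 := mul_nonneg (sq_nonneg ε) (n 1)
    have m2 := mul_nonneg (show 0 ≤ β * ε by positivity) (n 2)
    have m2' := mul_nonneg (show 0 ≤ β * ε ^ 2 by positivity) (n 2)
    have m3 := mul_nonneg (show 0 ≤ β ^ 2 * ε ^ 2 by positivity) (n 3)
    have m3' := mul_nonneg (show 0 ≤ β ^ 3 by positivity) (n 3)
    linarith [n 0]
  · fun_prop
  · fun_prop
  · have := (s 1).continuous
    have := (r 1).continuous
    have := (r 3).continuous
    fun_prop
  · repeat' first
      | assumption
      | apply DecaysOn.sub
      | apply DecaysOn.add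
      | apply DecaysOn.const_mul
      | apply DecaysOn.mul
  · intro t ht x
    have τ := fun k => hasDerivAt_mixedD_time hs k t x
    have ξ := fun k => hasDerivAt_mixedD_zero hs k t x
    have ζ := fun k => hasDerivAt_mixedD_one hs k t x
    refine ⟨_, _, (((((((τ 0).fun_pow 4).const_mul _).fun_add ((τ 0).fun_pow 2)).fun_add
      (((τ 1).fun_pow 2).const_mul _)).fun_add (((τ 2).fun_pow 2).const_mul _)).fun_add
      (((τ 3).fun_pow 2).const_mul _)),
      (((((((((((((ξ 0).fun_mul (ξ 0)).fun_mul (ξ 0)).const_mul _).fun_add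
        (((ξ 0).fun_mul (ξ 2)).const_mul _)).fun_sub (((ξ 1).fun_mul (ξ 1)).const_mul _)).fun_sub
        (((ξ 0).fun_mul (ζ 1)).const_mul _)).fun_add (((ξ 0).fun_mul (ζ 3)).const_mul _)).fun_sub
        (((ξ 1).fun_mul (ζ 2)).const_mul _)).fun_sub
        (((ξ 0).fun_mul (ξ 1)).const_mul _)).const_mul _).fun_add
        ((((((ξ 1).fun_mul (ζ 0)).const_mul _).fun_add
          (((ξ 2).fun_mul (ξ 2)).const_mul _)).fun_add
          (((ξ 2).fun_mul (ζ 3)).const_mul _)).const_mul _)).fun_add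
        ((((ξ 0).fun_mul (ξ 0)).fun_mul (ξ 0)).fun_mul
          (((((((ξ 0).fun_mul (ξ 0)).const_mul _).fun_add ((ξ 2).const_mul _)).fun_sub
            ((ζ 1).const_mul _)).fun_add ((ζ 3).const_mul _)).fun_sub
            ((ξ 1).const_mul _)))).fun_add
        (((((ζ 0).fun_mul (ζ 1)).fun_add (((ξ 2).fun_mul (ζ 2)).const_mul _)).fun_add
          (((ζ 3).fun_mul (ζ 2)).const_mul _)).const_mul _), ?_⟩
    have hbound : 18 * β * mixedD u 0 0 t x ^ 2 ≤ ε ^ 2 := by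
      have h₁ := mul_le_mul_of_nonneg_left (hu.sqrt_mul_sq_le hε hβ hdata ht.1.le x)
        (Real.sqrt_nonneg β)
      rw [← mul_assoc, Real.mul_self_sqrt hβ.le] at h₁
      linarith
    have hdiss := dissipation_lower_bound (u₁ := mixedD u 0 1 t x) (u₂ := mixedD u 0 2 t x)
      (v₁ := mixedD u 1 1 t x) (v₂ := mixedD u 1 2 t x) (v₃ := mixedD u 1 3 t x) hε hβ hbound
    push_cast
    linear_combination hdiss + (2 * mixedD u 0 0 t x - 2 * β * mixedD u 0 2 t x
      + mixedD u 0 0 t x ^ 3 - β * ε * mixedD u 1 2 t x) * hu.pde_mixedD ht.1 x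

/-- If `γ |uₓ| |∂ₜ∂ₓᵏ u|` is dominated by the dissipation, so is the corresponding entropy error
term `γ |η″(u)| |uₓ| |∂ₜ∂ₓᵏ u|`. -/
theorem integral_entropy_error_le (hu : IsAdmissibleKdVRLW ε β u) (hε : 0 < ε) (hβ : 0 < β)
    (hC0 : 0 ≤ C0) (hsmall : 36 * C0 * √β ≤ ε ^ 2) (hdata : DataBoundsKdVRLW ε β C0 (u 0))
    (hT : 0 ≤ T) {η : ℝ → ℝ} (hη : ContDiff ℝ 2 η) {M : ℝ}
    (hM : ∀ v, |iteratedDeriv 2 η v| ≤ M) {k : ℕ} {γ c : ℝ} (hγ : 0 ≤ γ) (hc : 0 ≤ c)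
    (hdom : ∀ t x, γ * (|mixedD u 0 1 t x| * |mixedD u 1 k t x|) ≤
      c * (1 / 4 * (ε * mixedD u 0 1 t x ^ 2 + β * ε * mixedD u 1 1 t x ^ 2
        + β ^ 3 * ε * mixedD u 1 3 t x ^ 2))) :
    γ * (∫ t in (0 : ℝ)..T, ∫ x : ℝ,
      |iteratedDeriv 2 η (u t x)| * |mixedD u 0 1 t x| * |mixedD u 1 k t x|) ≤
      M * c * (4 * C0) := by
  have hM0 : 0 ≤ M := (abs_nonneg _).trans (hM 0)
  have hη'' : Continuous (iteratedDeriv 2 η) := hη.continuous_iteratedDeriv 2 le_rfl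
  have cu : Continuous fun p : ℝ × ℝ => u p.1 p.2 := hu.smooth.continuous
  have c1 := (smooth_mixedD_zero hu.smooth 1).continuous
  have b1 := (smooth_mixedD_one hu.smooth 1).continuous
  have b3 := (smooth_mixedD_one hu.smooth 3).continuous
  have bk := (smooth_mixedD_one hu.smooth k).continuous
  have hg : Continuous fun p : ℝ × ℝ => γ * (|iteratedDeriv 2 η (u p.1 p.2)|
      * |mixedD u 0 1 p.1 p.2| * |mixedD u 1 k p.1 p.2|) := by fun_prop
  have hG : Continuous fun p : ℝ × ℝ => 1 / 4 * (ε * mixedD u 0 1 p.1 p.2 ^ 2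
      + β * ε * mixedD u 1 1 p.1 p.2 ^ 2 + β ^ 3 * ε * mixedD u 1 3 p.1 p.2 ^ 2) := by fun_prop
  have hpt : ∀ t x, γ * (|iteratedDeriv 2 η (u t x)| * |mixedD u 0 1 t x| * |mixedD u 1 k t x|) ≤
      M * c * (1 / 4 * (ε * mixedD u 0 1 t x ^ 2 + β * ε * mixedD u 1 1 t x ^ 2
        + β ^ 3 * ε * mixedD u 1 3 t x ^ 2)) := fun t x =>
    calc γ * (|iteratedDeriv 2 η (u t x)| * |mixedD u 0 1 t x| * |mixedD u 1 k t x|)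
        = |iteratedDeriv 2 η (u t x)| * (γ * (|mixedD u 0 1 t x| * |mixedD u 1 k t x|)) := by ring
      _ ≤ M * _ := mul_le_mul (hM _) (hdom t x) (by positivity) hM0
      _ = _ := by ring
  simp_rw [← intervalIntegral.integral_const_mul, ← integral_const_mul]
  refine integral_strip_le (K := M * c * (4 * C0)) hg (fun p => by positivity) hT (by positivity)
    (fun t ht => ?_) fun R hR => ?_
  · have j1 := (hu.integrable_sq ht.1 0 1 (by norm_num)).const_mul ε
    have j2 := (hu.integrable_sq ht.1 1 1 (by norm_num)).const_mul (β * ε)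
    have j3 := (hu.integrable_sq ht.1 1 3 (by norm_num)).const_mul (β ^ 3 * ε)
    refine ((((j1.fun_add j2).fun_add j3).const_mul (1 / 4)).const_mul (M * c)).mono'
      (hg.comp (Continuous.prodMk_right t)).aestronglyMeasurable (Eventually.of_forall fun x => ?_)
    rw [Real.norm_of_nonneg (by positivity)]
    exact hpt t x
  · have hcont : ∀ {F : ℝ × ℝ → ℝ}, Continuous F → Continuous fun t => ∫ x in -R..R, F (t, x) :=
      fun {F} hF => intervalIntegral.continuous_parametric_intervalIntegral_of_continuous'
        (f := fun t x => F (t, x)) (by simpa [Function.uncurry_def] using hF) _ _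
    calc _ ≤ ∫ t in (0 : ℝ)..T, M * c * ∫ x in -R..R, 1 / 4 * (ε * mixedD u 0 1 t x ^ 2
          + β * ε * mixedD u 1 1 t x ^ 2 + β ^ 3 * ε * mixedD u 1 3 t x ^ 2) := by
          refine intervalIntegral.integral_mono_on hT ((hcont hg).intervalIntegrable _ _)
            (((hcont hG).const_mul (M * c)).intervalIntegrable _ _) fun t _ => ?_
          rw [← intervalIntegral.integral_const_mul]
          exact intervalIntegral.integral_mono_on (by linarith)
            ((hg.comp (Continuous.prodMk_right t)).intervalIntegrable _ _)
            (((hG.comp (Continuous.prodMk_right t)).const_mul (M * c)).intervalIntegrable _ _)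
            fun x _ => hpt t x
      _ ≤ M * c * (4 * C0) := by
          rw [intervalIntegral.integral_const_mul]
          exact mul_le_mul_of_nonneg_left
            (hu.integral_dissipation_le hε hβ hsmall hdata hT hR) (by positivity)

end IsAdmissibleKdVRLW

/-- The `L¹`-type terms `I₆` and `I₈` vanish: `L¹` bounds on
`β η″(u) ∂ₓu ∂ₜ∂ₓu` and `β² η″(u) ∂ₓu ∂ₜ∂ₓ³u`. -/
theorem I6_I8_vanish_KdVRLW (C0 : ℝ) (hC0 : 0 < C0) :
    ∃ D : ℝ, 0 < D ∧ ∃ C : ℝ, 0 < C ∧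
      ∀ ε β : ℝ, 0 < ε → 0 < β → β ≤ D ^ 2 * ε ^ 4 →
        ∀ u : ℝ → ℝ → ℝ, IsAdmissibleKdVRLW ε β u →
          DataBoundsKdVRLW ε β C0 (u 0) →
          ∀ η : ℝ → ℝ, ContDiff ℝ 2 η →
            ∀ M : ℝ, (∀ v : ℝ, |iteratedDeriv 2 η v| ≤ M) →
              ∀ T > (0 : ℝ),
                (β * (∫ t in (0 : ℝ)..T, ∫ x : ℝ,
                      |iteratedDeriv 2 η (u t x)| * |mixedD u 0 1 t x| * |mixedD u 1 1 t x|)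
                    ≤ C * M * (Real.sqrt β / ε) ∧
                  C * M * (Real.sqrt β / ε) ≤ C * M * D * ε) ∧
                (β ^ 2 * (∫ t in (0 : ℝ)..T, ∫ x : ℝ,
                      |iteratedDeriv 2 η (u t x)| * |mixedD u 0 1 t x| * |mixedD u 1 3 t x|)
                    ≤ C * M * (Real.sqrt β / ε) ∧
                  C * M * (Real.sqrt β / ε) ≤ C * M * D * ε) := by
  refine ⟨1 / (36 * C0), by positivity, 8 * C0, by positivity, ?_⟩
  intro ε β hε hβ hβε u hu hdata η hη M hM T hT
  have hM0 : 0 ≤ M := (abs_nonneg _).trans (hM 0)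
  have hs : √β ≤ 1 / (36 * C0) * ε ^ 2 :=
    Real.sqrt_le_iff.2 ⟨by positivity, hβε.trans_eq (by ring)⟩
  have hsmall : 36 * C0 * √β ≤ ε ^ 2 := by
    have h := mul_le_mul_of_nonneg_left hs (by positivity : 0 ≤ 36 * C0)
    rwa [← mul_assoc, mul_one_div_cancel (by positivity), one_mul] at h
  have hlast : 8 * C0 * M * (√β / ε) ≤ 8 * C0 * M * (1 / (36 * C0)) * ε := by
    rw [mul_assoc (8 * C0 * M)]
    refine mul_le_mul_of_nonneg_left ?_ (by positivity)
    rw [div_le_iff₀ hε]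
    linarith
  have hK : M * (2 * (√β / ε)) * (4 * C0) = 8 * C0 * M * (√β / ε) := by ring
  have hsq : √β ^ 2 = β := Real.sq_sqrt hβ.le
  have hweight : ∀ a b d : ℝ, 2 * (√β / ε) *
      (1 / 4 * (ε * a ^ 2 + β * ε * b ^ 2 + β ^ 3 * ε * d ^ 2)) =
      √β / 2 * (|a| ^ 2 + √β ^ 2 * |b| ^ 2 + √β ^ 6 * |d| ^ 2) := by
    intro a b d
    rw [show √β ^ 6 = (√β ^ 2) ^ 3 by ring, hsq, sq_abs, sq_abs, sq_abs]
    field_simp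
    ring
  refine ⟨⟨?_, hlast⟩, ?_, hlast⟩ <;> rw [← hK]
  · refine hu.integral_entropy_error_le hε hβ hC0.le hsmall hdata hT.le hη hM
      hβ.le (by positivity) fun t x => ?_
    have h₀ : β * (|mixedD u 0 1 t x| * |mixedD u 1 1 t x|) =
        √β ^ 2 * (|mixedD u 0 1 t x| * |mixedD u 1 1 t x|) := by rw [hsq]
    rw [hweight, h₀]
    have h₁ := mul_nonneg (Real.sqrt_nonneg β)
      (sq_nonneg (|mixedD u 0 1 t x| - √β * |mixedD u 1 1 t x|))
    have h₂ : 0 ≤ √β * (√β ^ 6 * |mixedD u 1 3 t x| ^ 2) := by positivity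
    linarith
  · refine hu.integral_entropy_error_le hε hβ hC0.le hsmall hdata hT.le hη hM
      (by positivity) (by positivity) fun t x => ?_
    have h₀ : β ^ 2 * (|mixedD u 0 1 t x| * |mixedD u 1 3 t x|) =
        √β ^ 4 * (|mixedD u 0 1 t x| * |mixedD u 1 3 t x|) := by
      rw [show √β ^ 4 = (√β ^ 2) ^ 2 by ring, hsq]
    rw [hweight, h₀]
    have h₁ := mul_nonneg (Real.sqrt_nonneg β)
      (sq_nonneg (|mixedD u 0 1 t x| - √β ^ 3 * |mixedD u 1 3 t x|))
    have h₂ : 0 ≤ √β * (√β ^ 2 * |mixedD u 1 1 t x| ^ 2) := by positivity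
    linarith

end
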